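/- arXiv:1407.5189 — 4 statements merged into one kernel-verified Lean document; each statement's English description precedes it below -/
import Mathlib

section
/- Let X be a complex Hilbert space, A and A_n bounded linear operators on X with ‖A‖ ≤ 1 and ‖A_n‖ ≤ 1. Let μ, ρ, δ, γ > 0, v ∈ X with ‖v‖ ≤ ρ, x† = (A*A)^{μ/2} v, f = A x†, f_δ ∈ X with ‖f − f_δ‖ ≤ δ. Let K ≥ 2 be an integer, κ₀ ≥ 1, κ₂ > 0, κ_{μ+1} > 0, and let r be a real polynomial of degree at most K−1 satisfying |r(λ)| ≤ κ₀, |λ·r(λ)| ≤ κ₂/K² and λ^{(μ+1)/2}·|r(λ)| ≤ κ_{μ+1}/K^{μ+1} for all λ ∈ [0,1]. Assume ‖AA* − A_nA_n*‖ ≤ γδ/(2(K−1)ρ), let τ > κ₀·(1 + √(1/2 + κ₂/κ₀)·γ), and assume τ·δ < ‖r(A_nA_n*) f_δ‖. Then K < c₂·ρ^{1/(μ+1)}·δ^{−1/(μ+1)}, where c₂ = max{ (κ_{μ+1}/(τ − κ₀·(1 + √(1/2 + κ₂/κ₀)·γ)))^{1/(μ+1)}, 1 }. -/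
open Complex in
/-- The weights of the M. Riesz interpolation formula: the triangular wave `n - m` is a nonnegative
combination of the characters at the `2n`-th roots of `-1`. -/
lemma exists_riesz_weights {n : ℕ} (hn : 0 < n) :
    ∃ (d t : ℕ → ℝ), (∀ k, 0 ≤ d k) ∧ ∀ m : ℕ, m ≤ 2 * n →
      ∑ k ∈ Finset.range (2 * n), (d k : ℂ) * exp (m * (t k * I)) = n - m := by
  have hn' : (n : ℂ) ≠ 0 := by exact_mod_cast hn.ne'
  set ζ : ℂ := exp (2 * Real.pi * I / (4 * n : ℕ)) with hζ
  have hprim : IsPrimitiveRoot ζ (4 * n) := isPrimitiveRoot_exp _ (by omega)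
  set t : ℕ → ℝ := fun k => (2 * k + 1) * (Real.pi / (2 * n)) with ht
  set ω : ℕ → ℂ := fun k => exp (t k * I) with hω
  have hωζ : ∀ k, ω k = ζ ^ (2 * k + 1) := by
    intro k
    rw [hω, hζ, ← exp_nat_mul]
    simp only [ht]
    congr 1
    push_cast
    field_simp
    ring
  have hζ2 : ζ ^ (2 * n) = -1 := by
    rw [hζ, ← exp_nat_mul, ← exp_pi_mul_I]
    congr 1
    push_cast
    field_simp
    norm_num
  have hω2 : ∀ k, ω k ^ (2 * n) = -1 := by
    intro k
    rw [hωζ, ← pow_mul, mul_comm, pow_mul, hζ2, Odd.neg_one_pow ⟨k, rfl⟩]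
  have hω0 : ∀ k, ω k ≠ 0 := fun k => exp_ne_zero _
  have hω1 : ∀ k, 1 - ω k ≠ 0 := by
    intro k h
    have h1 : ω k = 1 := (sub_eq_zero.1 h).symm
    have := hω2 k
    rw [h1, one_pow] at this
    norm_num at this
  have hnormSq : ∀ k, (normSq (1 - ω k) : ℂ) * ω k = -(1 - ω k) ^ 2 := by
    intro k
    have hc : (starRingEnd ℂ) (ω k) = (ω k)⁻¹ := by
      rw [hω, ← exp_conj, ← exp_neg]
      simp
    rw [← mul_conj, map_sub, map_one, hc]
    field_simp [hω0 k]
    ring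
  have hsum : ∀ m : ℕ, 0 < m → m < 2 * n → ∑ k ∈ Finset.range (2 * n), ω k ^ m = 0 := by
    intro m hm0 hm
    have e : ∀ k, ω k ^ m = ζ ^ m * (ζ ^ (2 * m)) ^ k := by
      intro k
      rw [hωζ, ← pow_mul, ← pow_mul, ← pow_add]
      congr 1
      ring
    simp_rw [e, ← Finset.mul_sum]
    have hne : ζ ^ (2 * m) ≠ 1 := hprim.pow_ne_one_of_pos_of_lt (by omega) (by omega)
    have h1 : (ζ ^ (2 * m)) ^ (2 * n) = 1 := by
      rw [← pow_mul, show 2 * m * (2 * n) = 4 * n * m by ring, pow_mul, hprim.pow_eq_one, one_pow]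
    have := mul_geom_sum (ζ ^ (2 * m)) (2 * n)
    rw [h1, sub_self] at this
    rw [(mul_eq_zero.1 this).resolve_left (sub_ne_zero.2 hne), mul_zero]
  refine ⟨fun k => 1 / (n * normSq (1 - ω k)), t, fun k => by
    have := normSq_nonneg (1 - ω k); positivity, ?_⟩
  set F : ℕ → ℂ := fun m => ∑ k ∈ Finset.range (2 * n),
    ((1 / (n * normSq (1 - ω k)) : ℝ) : ℂ) * ω k ^ m with hF
  have hd : ∀ k, ((1 / (n * normSq (1 - ω k)) : ℝ) : ℂ) * (1 - ω k) ^ 2 = - ω k / n := by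
    intro k
    have h0 : (normSq (1 - ω k) : ℂ) ≠ 0 := by
      exact_mod_cast (normSq_pos.2 (hω1 k)).ne'
    push_cast
    rw [← neg_eq_iff_eq_neg.2 (hnormSq k)]
    field_simp
  have hrec : ∀ m, m + 2 ≤ 2 * n → F (m + 2) - F (m + 1) = F (m + 1) - F m := by
    intro m hm
    have : F (m + 2) - 2 * F (m + 1) + F m = 0 := by
      simp only [hF]
      rw [Finset.mul_sum, ← Finset.sum_sub_distrib, ← Finset.sum_add_distrib]
      have := hsum (m + 1) (by omega) (by omega)
      calc _ = ∑ k ∈ Finset.range (2 * n), (-1 / (n : ℂ)) * ω k ^ (m + 1) := by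
            refine Finset.sum_congr rfl fun k _ => ?_
            linear_combination (ω k ^ m) * hd k
        _ = 0 := by rw [← Finset.mul_sum, this, mul_zero]
    linear_combination this
  have hper : F (2 * n) = - F 0 := by
    simp only [hF, ← Finset.sum_neg_distrib]
    refine Finset.sum_congr rfl fun k _ => ?_
    rw [hω2]; ring
  have hper' : F (2 * n + 1) = - F 1 := by
    simp only [hF, ← Finset.sum_neg_distrib]
    refine Finset.sum_congr rfl fun k _ => ?_
    rw [pow_succ, hω2]; ring
  have hjump : F (2 * n + 1) - 2 * F (2 * n) + F (2 * n - 1) = 2 := by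
    obtain ⟨l, hl⟩ : ∃ l, 2 * n = l + 1 := ⟨2 * n - 1, by omega⟩
    have hl' : 2 * n - 1 = l := by omega
    rw [hl']
    simp only [hF]
    rw [Finset.mul_sum, ← Finset.sum_sub_distrib, ← Finset.sum_add_distrib]
    calc _ = ∑ k ∈ Finset.range (2 * n), (1 / (n : ℂ)) := by
          refine Finset.sum_congr rfl fun k _ => ?_
          have h2 := hω2 k
          have hd' := hd k
          rw [hl] at h2 ⊢
          linear_combination (ω k ^ l) * hd' - (1 / (n : ℂ)) * h2
      _ = 2 := by
          rw [Finset.sum_const, Finset.card_range, nsmul_eq_mul]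
          push_cast
          field_simp
  have hstep : ∀ m, m + 1 ≤ 2 * n → F (m + 1) - F m = F 1 - F 0 := by
    intro m
    induction m with
    | zero => intro _; rfl
    | succ m ih => intro hm; rw [hrec m (by omega), ih (by omega)]
  have haff : ∀ m, m ≤ 2 * n → F m = F 0 + m * (F 1 - F 0) := by
    intro m
    induction m with
    | zero => intro _; simp
    | succ m ih =>
      intro hm
      have h1 := hstep m hm
      have h2 := ih (by omega)
      push_cast
      linear_combination h1 + h2
  have hslope : F 1 - F 0 = -1 := by
    have h1 := hstep (2 * n - 1) (by omega)
    rw [show 2 * n - 1 + 1 = 2 * n by omega] at h1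
    linear_combination (-1 / 2 : ℂ) * hjump + (-1 / 2 : ℂ) * h1 - (1 / 2 : ℂ) * hper + (1 / 2 : ℂ) * hper'
  have hF0 : F 0 = n := by
    have h1 := haff (2 * n) le_rfl
    rw [hslope, hper] at h1
    push_cast at h1
    linear_combination (-1 / 2 : ℂ) * h1
  intro m hm
  have h1 := haff m hm
  rw [hslope, hF0] at h1
  simp_rw [exp_nat_mul]
  exact h1.trans (by ring)

open Complex in
/-- **M. Riesz interpolation weights**: the derivative at `0` of every exponential of frequency at
most `n` is a fixed combination of its values, with coefficients of total mass `n`. -/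
lemma exists_riesz_interpolation {n : ℕ} (hn : 0 < n) :
    ∃ (c : ℕ → ℂ) (t : ℕ → ℝ), ∑ k ∈ Finset.range (2 * n), ‖c k‖ = n ∧
      ∀ j : ℤ, |j| ≤ n → ∑ k ∈ Finset.range (2 * n), c k * exp (j * (t k * I)) = j * I := by
  obtain ⟨d, t, hd, h⟩ := exists_riesz_weights hn
  refine ⟨fun k => -I * d k * exp (n * (t k * I)), t, ?_, ?_⟩
  · have h0 := h 0 (Nat.zero_le _)
    simp only [CharP.cast_eq_zero, zero_mul, exp_zero, mul_one, sub_zero] at h0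
    have h1 : ∑ k ∈ Finset.range (2 * n), d k = n := by exact_mod_cast h0
    rw [← h1]
    refine Finset.sum_congr rfl fun k _ => ?_
    have : ‖exp (n * (t k * I))‖ = 1 := by
      have := norm_exp_ofReal_mul_I (n * t k)
      rw [← this]; push_cast; ring_nf
    rw [norm_mul, this]
    simp [abs_of_nonneg (hd k)]
  · intro j hj
    obtain ⟨m, hm⟩ : ∃ m : ℕ, (m : ℤ) = n + j := ⟨(n + j).toNat, by
      rw [Int.toNat_of_nonneg]; linarith [neg_abs_le j]⟩
    have hm2 : m ≤ 2 * n := by have := le_abs_self j; omega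
    have hmc : (m : ℂ) = n + j := by exact_mod_cast hm
    have h1 := h m hm2
    calc _ = -I * ∑ k ∈ Finset.range (2 * n), (d k : ℂ) * exp (m * (t k * I)) := by
          rw [Finset.mul_sum]
          refine Finset.sum_congr rfl fun k _ => ?_
          rw [hmc, add_mul, exp_add]
          ring
      _ = j * I := by rw [h1, hmc]; ring

/-- Trigonometric polynomials of degree at most `n` with coefficients in `B`. -/
noncomputable def trigPoly (B : Type*) [AddCommGroup B] [Module ℂ B] (n : ℕ) :
    Submodule ℂ (ℝ → B) :=
  Submodule.span ℂ {g | ∃ j : ℤ, |j| ≤ n ∧ ∃ a : B,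
    g = fun θ : ℝ => Complex.exp (j * (θ * Complex.I)) • a}

section TrigPoly

variable {B : Type*} [NormedRing B] [NormedAlgebra ℂ B]

lemma trigPoly_mono {m n : ℕ} (h : m ≤ n) : trigPoly B m ≤ trigPoly B n := by
  refine Submodule.span_mono ?_
  rintro g ⟨j, hj, a, rfl⟩
  exact ⟨j, hj.trans (by exact_mod_cast h), a, rfl⟩

lemma const_mem_trigPoly (n : ℕ) (a : B) : (fun _ : ℝ => a) ∈ trigPoly B n :=
  Submodule.subset_span ⟨0, by simp, a, by simp⟩

lemma trigPoly_mul_le (m n : ℕ) : trigPoly B m * trigPoly B n ≤ trigPoly B (m + n) := by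
  rw [trigPoly, trigPoly, Submodule.span_mul_span]
  refine Submodule.span_mono ?_
  rintro _ ⟨_, ⟨j, hj, a, rfl⟩, _, ⟨k, hk, b, rfl⟩, rfl⟩
  refine ⟨j + k, (abs_add_le j k).trans (by push_cast; exact add_le_add hj hk), a * b, ?_⟩
  funext θ
  simp only [Pi.mul_apply, smul_mul_smul_comm, ← Complex.exp_add]
  push_cast
  rw [add_mul]

lemma pow_mem_trigPoly {g : ℝ → B} (hg : g ∈ trigPoly B 1) (n : ℕ) : g ^ n ∈ trigPoly B n := by
  induction n with
  | zero => exact pow_zero g ▸ const_mem_trigPoly 0 (1 : B)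
  | succ n ih => exact pow_succ g n ▸ trigPoly_mul_le n 1 (Submodule.mul_mem_mul ih hg)

lemma cos_smul_add_sin_smul_mem_trigPoly (a b : B) :
    (fun θ : ℝ => Real.cos θ • a + Real.sin θ • b) ∈ trigPoly B 1 := by
  have h1 : (fun θ : ℝ => Complex.exp ((1 : ℤ) * (θ * Complex.I)) •
      ((1 / 2 : ℂ) • a - (Complex.I / 2) • b)) ∈ trigPoly B 1 :=
    Submodule.subset_span ⟨1, by simp, _, rfl⟩
  have h2 : (fun θ : ℝ => Complex.exp ((-1 : ℤ) * (θ * Complex.I)) •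
      ((1 / 2 : ℂ) • a + (Complex.I / 2) • b)) ∈ trigPoly B 1 :=
    Submodule.subset_span ⟨-1, by simp, _, rfl⟩
  convert Submodule.add_mem _ h1 h2 using 1
  funext θ
  have ha : Real.cos θ • a = (Complex.cos θ) • a := by
    rw [← Complex.ofReal_cos, Complex.coe_smul]
  have hb : Real.sin θ • b = (Complex.sin θ) • b := by
    rw [← Complex.ofReal_sin, Complex.coe_smul]
  simp only [Pi.add_apply, ha, hb, Complex.cos, Complex.sin]
  push_cast
  simp only [neg_mul, one_mul]
  module

lemma aeval_mem_trigPoly {g : ℝ → B} (hg : g ∈ trigPoly B 1) {p : Polynomial ℝ} {n : ℕ}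
    (hp : p.natDegree ≤ n) : (fun θ => Polynomial.aeval (g θ) p) ∈ trigPoly B n := by
  have : (fun θ => Polynomial.aeval (g θ) p) =
      ∑ i ∈ Finset.range (p.natDegree + 1), (p.coeff i : ℂ) • g ^ i := by
    funext θ
    simp [Polynomial.aeval_eq_sum_range]
  rw [this]
  refine Submodule.sum_mem _ fun i hi => Submodule.smul_mem _ _ ?_
  exact trigPoly_mono (by rw [Finset.mem_range] at hi; omega) (pow_mem_trigPoly hg i)

/-- M. Riesz's interpolation formula for vector-valued trigonometric polynomials. -/
lemma hasDerivAt_of_mem_trigPoly {n : ℕ} {c : ℕ → ℂ} {t : ℕ → ℝ}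
    (hc : ∀ j : ℤ, |j| ≤ n → ∑ k ∈ Finset.range (2 * n),
      c k * Complex.exp (j * (t k * Complex.I)) = j * Complex.I)
    {g : ℝ → B} (hg : g ∈ trigPoly B n) :
    HasDerivAt g (∑ k ∈ Finset.range (2 * n), c k • g (t k)) 0 := by
  induction hg using Submodule.span_induction with
  | mem g hg =>
    obtain ⟨j, hj, a, rfl⟩ := hg
    simp only [smul_smul, ← Finset.sum_smul]
    rw [hc j hj]
    have h : HasDerivAt (fun θ : ℝ => Complex.exp (j * (θ * Complex.I))) (j * Complex.I) 0 := by
      have h1 : HasDerivAt (fun z : ℂ => Complex.exp (j * (z * Complex.I)))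
          (j * Complex.I) ((0 : ℝ) : ℂ) := by
        have := (((hasDerivAt_id ((0 : ℝ) : ℂ)).mul_const Complex.I).const_mul (j : ℂ)).cexp
        simpa using this
      exact h1.comp_ofReal
    exact h.smul_const a
  | zero => simp
  | add x y _ _ hx hy =>
    simp only [Pi.add_apply, smul_add, Finset.sum_add_distrib]
    exact hx.add hy
  | smul a x _ hx =>
    have := hx.const_smul a
    simp only [Finset.smul_sum] at this
    simp only [Pi.smul_apply, smul_comm (c _) a]
    exact this

/-- **Markov's inequality** for the derivative of a polynomial acting on a normed algebra: if `p`
is bounded by `M` on the points `cos θ cos φ • S + sin θ sin φ • H`, then its derivative at `S` in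
the direction `H` is bounded by `n ^ 2 * M`. -/
lemma norm_fderiv_aeval_le_of_trig {n : ℕ} (hn : 0 < n) {p : Polynomial ℝ} (hp : p.natDegree ≤ n)
    {M : ℝ} {S H : B}
    (hM : ∀ θ φ : ℝ, ‖Polynomial.aeval ((Real.cos θ * Real.cos φ) • S +
      (Real.sin θ * Real.sin φ) • H) p‖ ≤ M) :
    ‖fderiv ℝ (fun T : B => Polynomial.aeval T p) S H‖ ≤ n ^ 2 * M := by
  obtain ⟨c, t, hsum, hc⟩ := exists_riesz_interpolation hn
  set P : B → B := fun T => Polynomial.aeval T p with hP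
  have hPd : ContDiff ℝ 1 P := by
    simp only [hP, Polynomial.aeval_eq_sum_range]
    fun_prop
  have hmem1 : ∀ θ : ℝ, (fun φ : ℝ => P ((Real.cos θ * Real.cos φ) • S +
      (Real.sin θ * Real.sin φ) • H)) ∈ trigPoly B n := by
    intro θ
    refine aeval_mem_trigPoly ?_ hp
    convert cos_smul_add_sin_smul_mem_trigPoly (Real.cos θ • S) (Real.sin θ • H) using 3
    · rw [smul_smul, mul_comm]
    · rw [smul_smul, mul_comm]
  have hmem2 : ∀ φ : ℝ, (fun θ : ℝ => P ((Real.cos θ * Real.cos φ) • S +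
      (Real.sin θ * Real.sin φ) • H)) ∈ trigPoly B n := by
    intro φ
    refine aeval_mem_trigPoly ?_ hp
    convert cos_smul_add_sin_smul_mem_trigPoly (Real.cos φ • S) (Real.sin φ • H) using 3
    · rw [smul_smul]
    · rw [smul_smul]
  set s : ℝ → B := fun θ => Real.sin θ • fderiv ℝ P (Real.cos θ • S) H with hs
  have hs1 : s = ∑ k ∈ Finset.range (2 * n), c k • (fun θ : ℝ =>
      P ((Real.cos θ * Real.cos (t k)) • S + (Real.sin θ * Real.sin (t k)) • H)) := by
    funext θ
    have h1 := hasDerivAt_of_mem_trigPoly hc (hmem1 θ)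
    have h2 : HasDerivAt (fun φ : ℝ => (Real.cos θ * Real.cos φ) • S +
        (Real.sin θ * Real.sin φ) • H) (Real.sin θ • H) 0 := by
      have := (((Real.hasDerivAt_cos 0).const_mul (Real.cos θ)).smul_const S).fun_add
        (((Real.hasDerivAt_sin 0).const_mul (Real.sin θ)).smul_const H)
      simpa using this
    have h3 : HasFDerivAt P (fderiv ℝ P (Real.cos θ • S))
        ((Real.cos θ * Real.cos 0) • S + (Real.sin θ * Real.sin 0) • H) := by
      have := (hPd.differentiable (by norm_num) (Real.cos θ • S)).hasFDerivAt
      simpa using this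
    have h4 := h3.comp_hasDerivAt (0 : ℝ) h2
    have h5 := h4.unique h1
    simp only [map_smul] at h5
    simp only [hs, h5, Finset.sum_apply, Pi.smul_apply]
  have hsmem : s ∈ trigPoly B n := by
    rw [hs1]
    exact Submodule.sum_mem _ fun k _ => Submodule.smul_mem _ _ (hmem2 _)
  have hsd : HasDerivAt s (fderiv ℝ P S H) 0 := by
    have hcont : Continuous fun θ : ℝ => fderiv ℝ P (Real.cos θ • S) H := by
      have := hPd.continuous_fderiv (by norm_num)
      fun_prop
    have hsin := Real.hasDerivAt_sin 0
    rw [hasDerivAt_iff_tendsto_slope] at hsin ⊢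
    have h1 := hsin.smul ((hcont.tendsto 0).mono_left (nhdsWithin_le_nhds (s := {0}ᶜ)))
    simp only [Real.cos_zero, one_smul] at h1
    refine h1.congr fun θ => ?_
    simp [slope, hs, smul_smul]
  have hval := hsd.unique (hasDerivAt_of_mem_trigPoly hc hsmem)
  have hM' : ∀ θ, ‖s θ‖ ≤ n * M := by
    intro θ
    rw [hs1, Finset.sum_apply]
    refine (norm_sum_le _ _).trans ?_
    rw [← hsum, Finset.sum_mul]
    refine Finset.sum_le_sum fun k _ => ?_
    rw [Pi.smul_apply, norm_smul]
    exact mul_le_mul_of_nonneg_left (hM _ _) (norm_nonneg _)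
  rw [hval]
  refine (norm_sum_le _ _).trans ?_
  calc _ ≤ ∑ k ∈ Finset.range (2 * n), ‖c k‖ * (n * M) := by
        refine Finset.sum_le_sum fun k _ => ?_
        rw [norm_smul]
        exact mul_le_mul_of_nonneg_left (hM' _) (norm_nonneg _)
    _ = n ^ 2 * M := by rw [← Finset.sum_mul, hsum]; ring

end TrigPoly

section CStarAlgebra

variable {B : Type*} [CStarAlgebra B]

lemma IsSelfAdjoint.norm_aeval_le {a : B} (ha : IsSelfAdjoint a) {p : Polynomial ℝ} {M : ℝ}
    (hM : 0 ≤ M) (h : ∀ x ∈ spectrum ℝ a, |p.eval x| ≤ M) : ‖Polynomial.aeval a p‖ ≤ M := by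
  rw [← cfc_polynomial p a ha]
  exact norm_cfc_le hM h

lemma mem_Icc_of_mem_spectrum_of_norm_le_one {a : B} (ha : ‖a‖ ≤ 1) {x : ℝ}
    (hx : x ∈ spectrum ℝ a) : x ∈ Set.Icc (-1 : ℝ) 1 := by
  have : Nontrivial B := by
    by_contra h
    have := not_nontrivial_iff_subsingleton.1 h
    simp at hx
  exact abs_le.1 ((spectrum.norm_le_norm_of_mem hx).trans ha)

/-- **Markov's inequality** for self-adjoint contractions. -/
lemma norm_aeval_sub_aeval_le {n : ℕ} (hn : 0 < n) {p : Polynomial ℝ} (hp : p.natDegree ≤ n)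
    {M : ℝ} (hM : ∀ x ∈ Set.Icc (-1 : ℝ) 1, |p.eval x| ≤ M) {S T : B}
    (hS : IsSelfAdjoint S) (hT : IsSelfAdjoint T) (hS1 : ‖S‖ ≤ 1) (hT1 : ‖T‖ ≤ 1) :
    ‖Polynomial.aeval S p - Polynomial.aeval T p‖ ≤ n ^ 2 * M * ‖S - T‖ := by
  rcases eq_or_ne S T with rfl | hne
  · simp
  have hM0 : 0 ≤ M := (abs_nonneg _).trans (hM 0 (by simp))
  set P : B → B := fun T => Polynomial.aeval T p with hP
  have hPd : ContDiff ℝ 1 P := by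
    simp only [hP, Polynomial.aeval_eq_sum_range]
    fun_prop
  have hN : 0 < ‖S - T‖ := norm_pos_iff.2 (sub_ne_zero.2 hne)
  set H : B := ‖S - T‖⁻¹ • (S - T) with hH
  have hHsa : IsSelfAdjoint H := (IsSelfAdjoint.all _).smul (hS.sub hT)
  have hH1 : ‖H‖ = 1 := by
    rw [hH, norm_smul, norm_inv, norm_norm, inv_mul_cancel₀ hN.ne']
  have hST : S - T = ‖S - T‖ • H := by rw [hH, smul_inv_smul₀ hN.ne']
  have hbound : ∀ R : B, IsSelfAdjoint R → ‖R‖ ≤ 1 → ‖fderiv ℝ P R H‖ ≤ n ^ 2 * M := by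
    intro R hR hR1
    refine norm_fderiv_aeval_le_of_trig hn hp fun θ φ => ?_
    refine IsSelfAdjoint.norm_aeval_le ?_ hM0 fun x hx =>
      hM x (mem_Icc_of_mem_spectrum_of_norm_le_one ?_ hx)
    · exact ((IsSelfAdjoint.all _).smul hR).add ((IsSelfAdjoint.all _).smul hHsa)
    · refine (norm_add_le _ _).trans ?_
      rw [norm_smul, norm_smul, hH1, Real.norm_eq_abs, Real.norm_eq_abs, abs_mul, abs_mul]
      have h1 := Real.cos_sq_add_sin_sq θ
      have h2 := Real.cos_sq_add_sin_sq φ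
      rw [← sq_abs (Real.cos θ), ← sq_abs (Real.sin θ)] at h1
      rw [← sq_abs (Real.cos φ), ← sq_abs (Real.sin φ)] at h2
      have h3 : |Real.cos θ| * |Real.cos φ| * ‖R‖ ≤ |Real.cos θ| * |Real.cos φ| :=
        mul_le_of_le_one_right (by positivity) hR1
      nlinarith [sq_nonneg (|Real.cos θ| - |Real.cos φ|), sq_nonneg (|Real.sin θ| - |Real.sin φ|)]
  have hderiv : ∀ u : ℝ, HasDerivAt (fun u : ℝ => P (T + u • (S - T)))
      (fderiv ℝ P (T + u • (S - T)) (S - T)) u := by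
    intro u
    have h1 : HasDerivAt (fun u : ℝ => T + u • (S - T)) (S - T) u := by
      simpa using ((hasDerivAt_id u).smul_const (S - T)).const_add T
    exact (hPd.differentiable (by norm_num) _).hasFDerivAt.comp_hasDerivAt u h1
  have key := norm_image_sub_le_of_norm_deriv_le_segment_01'
    (C := n ^ 2 * M * ‖S - T‖) (fun u _ => (hderiv u).hasDerivWithinAt) ?_
  · simpa [hP] using key
  · intro u hu
    have hR : IsSelfAdjoint (T + u • (S - T)) :=
      hT.add ((IsSelfAdjoint.all _).smul (hS.sub hT))
    have hR1 : ‖T + u • (S - T)‖ ≤ 1 := by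
      have : T + u • (S - T) = (1 - u) • T + u • S := by module
      rw [this]
      refine (norm_add_le _ _).trans ?_
      rw [norm_smul, norm_smul, Real.norm_of_nonneg hu.1,
        Real.norm_of_nonneg (sub_nonneg.2 hu.2.le)]
      nlinarith [hu.1, hu.2]
    calc _ = ‖‖S - T‖ • fderiv ℝ P (T + u • (S - T)) H‖ := by
          rw [← map_smul, ← hST]
      _ = ‖S - T‖ * ‖fderiv ℝ P (T + u • (S - T)) H‖ := by rw [norm_smul, norm_norm]
      _ ≤ ‖S - T‖ * (n ^ 2 * M) := by gcongr; exact hbound _ hR hR1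
      _ = _ := by ring

/-- **Markov's inequality** for self-adjoint elements with spectrum in `[0, 1]`. -/
lemma norm_aeval_sub_aeval_le_of_spectrum_subset {n : ℕ} (hn : 0 < n) {p : Polynomial ℝ}
    (hp : p.natDegree ≤ n) {M : ℝ} (hM : ∀ x ∈ Set.Icc (0 : ℝ) 1, |p.eval x| ≤ M) {S T : B}
    (hS : IsSelfAdjoint S) (hT : IsSelfAdjoint T) (hS1 : spectrum ℝ S ⊆ Set.Icc 0 1)
    (hT1 : spectrum ℝ T ⊆ Set.Icc 0 1) :
    ‖Polynomial.aeval S p - Polynomial.aeval T p‖ ≤ 2 * n ^ 2 * M * ‖S - T‖ := by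
  set ℓ : Polynomial ℝ := Polynomial.C 2 * Polynomial.X - 1 with hℓ
  set q : Polynomial ℝ := p.comp (Polynomial.C (1 / 2) * (Polynomial.X + 1)) with hq
  have hqℓ : q.comp ℓ = p := by
    have : (Polynomial.C (1 / 2 : ℝ) * (Polynomial.X + 1)).comp ℓ = Polynomial.X := by
      rw [hℓ]
      simp only [Polynomial.mul_comp, Polynomial.C_comp, Polynomial.add_comp, Polynomial.X_comp,
        Polynomial.one_comp, sub_add_cancel]
      rw [← mul_assoc, ← Polynomial.C_mul]
      norm_num
    rw [hq, Polynomial.comp_assoc, this, Polynomial.comp_X]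
  have hqd : q.natDegree ≤ n := by
    refine Polynomial.natDegree_comp_le.trans ?_
    have : (Polynomial.C (1 / 2 : ℝ) * (Polynomial.X + 1)).natDegree ≤ 1 := by compute_degree
    exact (Nat.mul_le_mul hp this).trans (by omega)
  have hqM : ∀ x ∈ Set.Icc (-1 : ℝ) 1, |q.eval x| ≤ M := by
    intro x hx
    rw [hq, Polynomial.eval_comp]
    refine hM _ ?_
    simp only [Polynomial.eval_mul, Polynomial.eval_C, Polynomial.eval_add, Polynomial.eval_X,
      Polynomial.eval_one]
    exact ⟨by linarith [hx.1], by linarith [hx.2]⟩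
  have hℓa : ∀ a : B, Polynomial.aeval a ℓ = (2 : ℝ) • a - 1 := by
    intro a
    simp [hℓ, Algebra.smul_def]
  have hsa : ∀ a : B, IsSelfAdjoint a → IsSelfAdjoint (Polynomial.aeval a ℓ) := by
    intro a ha
    rw [hℓa]
    exact ((IsSelfAdjoint.all _).smul ha).sub (.one B)
  have hnorm : ∀ a : B, IsSelfAdjoint a → spectrum ℝ a ⊆ Set.Icc 0 1 →
      ‖Polynomial.aeval a ℓ‖ ≤ 1 := by
    intro a ha h
    refine ha.norm_aeval_le zero_le_one fun x hx => ?_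
    have := h hx
    simp only [hℓ, Polynomial.eval_sub, Polynomial.eval_mul, Polynomial.eval_C, Polynomial.eval_X,
      Polynomial.eval_one]
    exact abs_le.2 ⟨by linarith [this.1], by linarith [this.2]⟩
  have key := norm_aeval_sub_aeval_le hn hqd hqM (hsa S hS) (hsa T hT) (hnorm S hS hS1)
    (hnorm T hT hT1)
  rw [← Polynomial.aeval_comp, ← Polynomial.aeval_comp, hqℓ, hℓa, hℓa, sub_sub_sub_cancel_right,
    ← smul_sub, norm_smul] at key
  refine key.trans (le_of_eq ?_)
  rw [Real.norm_of_nonneg zero_le_two]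
  ring

lemma spectrum_star_mul_self_subset_Icc {a : B} (ha : ‖a‖ ≤ 1) :
    spectrum ℝ (star a * a) ⊆ Set.Icc 0 1 := by
  intro x hx
  refine ⟨spectrum_star_mul_self_nonneg x hx, (mem_Icc_of_mem_spectrum_of_norm_le_one ?_ hx).2⟩
  rw [CStarRing.norm_star_mul_self]
  exact mul_le_one₀ ha (norm_nonneg _) ha

lemma spectrum_mul_star_self_subset_Icc {a : B} (ha : ‖a‖ ≤ 1) :
    spectrum ℝ (a * star a) ⊆ Set.Icc 0 1 := by
  simpa using spectrum_star_mul_self_subset_Icc (a := star a) (by rwa [norm_star])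

lemma aeval_mul_star_self_mul (a : B) (p : Polynomial ℝ) :
    Polynomial.aeval (a * star a) p * a = a * Polynomial.aeval (star a * a) p := by
  simp only [Polynomial.aeval_eq_sum_range, Finset.sum_mul, Finset.mul_sum, smul_mul_assoc,
    mul_smul_comm]
  refine Finset.sum_congr rfl fun i _ => ?_
  have h : SemiconjBy a (star a * a) (a * star a) := (mul_assoc a (star a) a).symm
  rw [(h.pow_right i).eq]

lemma IsSelfAdjoint.aeval_real {a : B} (ha : IsSelfAdjoint a) (p : Polynomial ℝ) :
    IsSelfAdjoint (Polynomial.aeval a p) := by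
  rw [← cfc_polynomial p a ha]
  exact cfc_predicate _ a

/-- Perturbation bound for `r(a a*) a` when `r` is a residual polynomial of degree at most `n`. -/
lemma norm_aeval_sub_aeval_mul_le {n : ℕ} (hn : 0 < n) {r : Polynomial ℝ} (hr : r.natDegree ≤ n)
    {κ₀ κ₂ : ℝ} (hκ₀ : 0 < κ₀) (hκ₂ : 0 ≤ κ₂)
    (h₀ : ∀ x ∈ Set.Icc (0 : ℝ) 1, |r.eval x| ≤ κ₀)
    (h₂ : ∀ x ∈ Set.Icc (0 : ℝ) 1, |x * r.eval x| ≤ κ₂ / ((n : ℝ) + 1) ^ 2)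
    {a b : B} (ha : ‖a‖ ≤ 1) (hb : ‖b‖ ≤ 1) :
    ‖(Polynomial.aeval (b * star b) r - Polynomial.aeval (a * star a) r) * a‖ ≤
      2 * n * κ₀ * √(1 / 2 + κ₂ / κ₀) * ‖a * star a - b * star b‖ := by
  set S := a * star a with hS
  set T := b * star b with hT
  have hSsa : IsSelfAdjoint S := .mul_star_self a
  have hTsa : IsSelfAdjoint T := .mul_star_self b
  have hS1 : spectrum ℝ S ⊆ Set.Icc 0 1 := spectrum_mul_star_self_subset_Icc ha
  have hT1 : spectrum ℝ T ⊆ Set.Icc 0 1 := spectrum_mul_star_self_subset_Icc hb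
  set D := Polynomial.aeval T r - Polynomial.aeval S r with hD
  have hDsa : IsSelfAdjoint D := (hTsa.aeval_real r).sub (hSsa.aeval_real r)
  set ε := ‖S - T‖ with hε
  have hε0 : 0 ≤ ε := norm_nonneg _
  have hD1 : ‖D‖ ≤ 2 * n ^ 2 * κ₀ * ε := by
    rw [hε, norm_sub_rev S T]
    exact norm_aeval_sub_aeval_le_of_spectrum_subset hn hr h₀ hTsa hSsa hT1 hS1
  have hDS : ‖D * S‖ ≤ (κ₀ + 2 * κ₂) * ε := by
    have hq : ‖Polynomial.aeval T (Polynomial.X * r) - Polynomial.aeval S (Polynomial.X * r)‖ ≤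
        2 * κ₂ * ε := by
      have hd : (Polynomial.X * r).natDegree ≤ n + 1 := by
        refine Polynomial.natDegree_mul_le.trans ?_
        have := Polynomial.natDegree_X_le (R := ℝ)
        omega
      have := norm_aeval_sub_aeval_le_of_spectrum_subset (Nat.succ_pos n) hd
        (M := κ₂ / ((n : ℝ) + 1) ^ 2) (fun x hx => by simpa using h₂ x hx) hTsa hSsa hT1 hS1
      rw [norm_sub_rev T S] at this
      refine this.trans (le_of_eq ?_)
      push_cast
      rw [hε]
      field_simp
    have heq : D * S = (Polynomial.aeval T (Polynomial.X * r) -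
        Polynomial.aeval S (Polynomial.X * r)) + Polynomial.aeval T r * (S - T) := by
      rw [mul_comm Polynomial.X r]
      simp only [hD, map_mul, Polynomial.aeval_X]
      noncomm_ring
    have hrT : ‖Polynomial.aeval T r‖ ≤ κ₀ :=
      hTsa.norm_aeval_le hκ₀.le fun x hx => h₀ x (hT1 hx)
    calc ‖D * S‖ ≤ 2 * κ₂ * ε + ‖Polynomial.aeval T r * (S - T)‖ := by
          rw [heq]; exact (norm_add_le _ _).trans (by gcongr)
      _ ≤ 2 * κ₂ * ε + κ₀ * ε := by
          gcongr; exact (norm_mul_le _ _).trans (by gcongr)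
      _ = _ := by ring
  refine abs_le_of_sq_le_sq' ?_ (by positivity) |>.2
  calc ‖D * a‖ ^ 2 = ‖D * S * D‖ := by
        rw [sq, ← CStarRing.norm_self_mul_star, star_mul, hDsa.star_eq, hS]
        simp only [mul_assoc]
    _ ≤ ((κ₀ + 2 * κ₂) * ε) * (2 * n ^ 2 * κ₀ * ε) :=
        (norm_mul_le _ _).trans (by gcongr)
    _ = _ := by
        rw [mul_pow, mul_pow (2 * n * κ₀), Real.sq_sqrt (by positivity)]
        field_simp

/-- The bound on `r(a a*) a (a* a)^(μ / 2)` through the weighted supremum of `r`. -/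
lemma norm_aeval_mul_cfc_rpow_le {r : Polynomial ℝ} {μ M : ℝ} (hμ : 0 < μ) (hM : 0 ≤ M)
    (h : ∀ x ∈ Set.Icc (0 : ℝ) 1, x ^ ((μ + 1) / 2) * |r.eval x| ≤ M) {a : B} (ha : ‖a‖ ≤ 1) :
    ‖Polynomial.aeval (a * star a) r * a * cfc (fun t : ℝ => t ^ (μ / 2)) (star a * a)‖ ≤ M := by
  set Q := star a * a with hQ
  have hQsa : IsSelfAdjoint Q := .star_mul_self a
  have hQ1 : spectrum ℝ Q ⊆ Set.Icc 0 1 := spectrum_star_mul_self_subset_Icc ha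
  have hpow : Continuous fun t : ℝ => t ^ (μ / 2) := Real.continuous_rpow_const (by positivity)
  set g : ℝ → ℝ := fun x => r.eval x * x ^ (μ / 2) with hg
  have hgc : Continuous g := r.continuous.mul hpow
  have hG : Polynomial.aeval Q r * cfc (fun t : ℝ => t ^ (μ / 2)) Q = cfc g Q := by
    rw [hg, cfc_mul _ _ Q r.continuous.continuousOn hpow.continuousOn, cfc_polynomial r Q hQsa]
  have hGsa : IsSelfAdjoint (cfc g Q) := cfc_predicate _ _
  rw [aeval_mul_star_self_mul, mul_assoc, hG]
  refine abs_le_of_sq_le_sq' ?_ hM |>.2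
  calc ‖a * cfc g Q‖ ^ 2 = ‖cfc g Q * Q * cfc g Q‖ := by
        rw [sq, ← CStarRing.norm_star_mul_self, star_mul, hGsa.star_eq, hQ]
        simp only [mul_assoc]
    _ = ‖cfc (fun x => g x * x * g x) Q‖ := by
        rw [cfc_mul (fun x => g x * x) g Q (hgc.mul continuous_id).continuousOn hgc.continuousOn,
          cfc_mul g (fun x => x) Q hgc.continuousOn continuousOn_id, cfc_id' ℝ Q]
    _ ≤ M ^ 2 := by
        refine norm_cfc_le (sq_nonneg M) fun x hx => ?_
        have hx := hQ1 hx
        have h1 := h x hx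
        have h2 : g x * x * g x = (x ^ ((μ + 1) / 2) * |r.eval x|) ^ 2 := by
          rw [mul_pow, sq_abs, ← Real.rpow_mul_natCast hx.1, hg]
          have e1 : (μ + 1) / 2 * (2 : ℕ) = μ + 1 := by push_cast; ring
          have e2 : x ^ (μ + 1) = x ^ (μ / 2) * x ^ (μ / 2) * x := by
            rw [← Real.rpow_add_of_nonneg hx.1 (by positivity) (by positivity),
              Real.rpow_add_of_nonneg hx.1 hμ.le zero_le_one, Real.rpow_one]
            ring_nf
          rw [e1, e2]
          ring
        rw [h2, Real.norm_of_nonneg (sq_nonneg _)]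
        have := Real.rpow_nonneg hx.1 ((μ + 1) / 2)
        gcongr

end CStarAlgebra

/-- The arithmetic step from the discrepancy inequality to the bound on the stopping index. -/
lemma lt_max_mul_rpow_of_mul_lt {k σ δ ρ c s : ℝ} (hk : 0 < k) (hσ : 0 < σ) (hδ : 0 < δ)
    (hρ : 0 < ρ) (hc : 0 < c) (hs : 0 < s) (h : σ * δ < c / k ^ s * ρ) :
    k < max ((c / σ) ^ (1 / s)) 1 * ρ ^ (1 / s) * δ ^ (-(1 / s)) := by
  have hks : 0 < k ^ s := Real.rpow_pos_of_pos hk s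
  have h1 : k ^ s < c / σ * ρ / δ := by
    rw [lt_div_iff₀ hδ, div_mul_eq_mul_div, lt_div_iff₀ hσ]
    rw [div_mul_eq_mul_div, lt_div_iff₀ hks] at h
    linarith
  have h2 := Real.rpow_lt_rpow hks.le h1 (one_div_pos.2 hs)
  rw [← Real.rpow_mul hk.le, mul_one_div_cancel hs.ne', Real.rpow_one,
    Real.div_rpow (by positivity) hδ.le, Real.mul_rpow (by positivity) hρ.le, div_eq_mul_inv,
    ← Real.rpow_neg hδ.le] at h2
  refine h2.trans_le ?_
  gcongr
  exact le_max_left _ _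

open ContinuousLinearMap in
theorem stmt_10 {X : Type*} [NormedAddCommGroup X] [InnerProductSpace ℂ X] [CompleteSpace X]
    (A An : X →L[ℂ] X) (hA : ‖A‖ ≤ 1) (hAn : ‖An‖ ≤ 1)
    (μ ρ δ γ : ℝ) (hμ : 0 < μ) (hρ : 0 < ρ) (hδ : 0 < δ) (hγ : 0 < γ)
    (v : X) (hv : ‖v‖ ≤ ρ)
    (xdag : X) (hxdag : xdag = (cfc (fun t : ℝ => t ^ (μ / 2)) (adjoint A * A)) v)
    (f : X) (hf : f = A xdag)
    (fδ : X) (hfδ : ‖f - fδ‖ ≤ δ)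
    (K : ℕ) (hK : 2 ≤ K)
    (κ₀ κ₂ κμ1 : ℝ) (hκ₀ : 1 ≤ κ₀) (hκ₂ : 0 < κ₂) (hκμ1 : 0 < κμ1)
    (r : Polynomial ℝ) (hdeg : r.natDegree ≤ K - 1)
    (hi : ∀ x ∈ Set.Icc (0:ℝ) 1, |r.eval x| ≤ κ₀)
    (hii : ∀ x ∈ Set.Icc (0:ℝ) 1, |x * r.eval x| ≤ κ₂ / (K : ℝ) ^ 2)
    (hiii : ∀ x ∈ Set.Icc (0:ℝ) 1, x ^ ((μ + 1) / 2) * |r.eval x| ≤ κμ1 / (K : ℝ) ^ (μ + 1))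
    (hd : ‖A * adjoint A - An * adjoint An‖ ≤ γ * δ / (2 * ((K : ℝ) - 1) * ρ))
    (τ : ℝ) (hτ : κ₀ * (1 + Real.sqrt (1 / 2 + κ₂ / κ₀) * γ) < τ)
    (hdiscr : τ * δ < ‖(Polynomial.aeval (An * adjoint An) (r.map (algebraMap ℝ ℂ))) fδ‖) :
    (K : ℝ) < max ((κμ1 / (τ - κ₀ * (1 + Real.sqrt (1 / 2 + κ₂ / κ₀) * γ))) ^ (1 / (μ + 1))) 1 *
        ρ ^ (1 / (μ + 1)) * δ ^ (-(1 / (μ + 1))) := by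
  obtain ⟨n, rfl⟩ : ∃ n, K = n + 1 := ⟨K - 1, by omega⟩
  have hn : 0 < n := by omega
  have hn' : (0 : ℝ) < n := by exact_mod_cast hn
  have hκ₀' : 0 < κ₀ := by linarith
  simp only [← star_eq_adjoint] at hxdag hd hdiscr
  push_cast at hd hii hiii ⊢
  rw [add_sub_cancel_right] at hd
  rw [Polynomial.aeval_map_algebraMap] at hdiscr
  set R := Polynomial.aeval (An * star An) r with hR
  set C := √(1 / 2 + κ₂ / κ₀) with hC
  have hRn : ‖R‖ ≤ κ₀ := (IsSelfAdjoint.mul_star_self An).norm_aeval_le hκ₀'.le fun x hx =>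
    hi x (spectrum_mul_star_self_subset_Icc hAn hx)
  have hx : ‖xdag‖ ≤ ρ := by
    have hcfc : ‖cfc (fun t : ℝ => t ^ (μ / 2)) (star A * A)‖ ≤ 1 := by
      refine norm_cfc_le zero_le_one fun x hx => ?_
      have hx := spectrum_star_mul_self_subset_Icc hA hx
      rw [Real.norm_of_nonneg (Real.rpow_nonneg hx.1 _)]
      exact Real.rpow_le_one hx.1 hx.2 (by positivity)
    rw [hxdag]
    exact (le_of_opNorm_le _ hcfc v).trans (by rwa [one_mul])
  have hM : 0 ≤ κμ1 / ((n : ℝ) + 1) ^ (μ + 1) := by positivity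
  have hsource : ‖Polynomial.aeval (A * star A) r f‖ ≤ κμ1 / ((n : ℝ) + 1) ^ (μ + 1) * ρ := by
    have h1 := norm_aeval_mul_cfc_rpow_le hμ hM hiii hA
    have h2 := le_of_opNorm_le _ h1 v
    rw [hf, hxdag]
    exact h2.trans (by gcongr)
  have hpert : ‖(R - Polynomial.aeval (A * star A) r) f‖ ≤ κ₀ * C * γ * δ := by
    have h1 := norm_aeval_sub_aeval_mul_le hn hdeg hκ₀' hκ₂.le hi hii hA hAn
    have h2 := le_of_opNorm_le _ h1 xdag
    rw [hf]
    refine h2.trans ?_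
    calc _ ≤ 2 * n * κ₀ * C * (γ * δ / (2 * n * ρ)) * ρ := by gcongr
      _ = _ := by field_simp
  have hnoise : ‖R (fδ - f)‖ ≤ κ₀ * δ := by
    rw [norm_sub_rev] at hfδ
    exact (le_of_opNorm_le _ hRn _).trans (by gcongr)
  have hsplit : R fδ = R (fδ - f) + (R - Polynomial.aeval (A * star A) r) f +
      Polynomial.aeval (A * star A) r f := by
    simp only [map_sub, sub_apply]
    abel
  have htotal : ‖R fδ‖ ≤ κ₀ * δ + κ₀ * C * γ * δ + κμ1 / ((n : ℝ) + 1) ^ (μ + 1) * ρ := by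
    rw [hsplit]
    exact norm_add₃_le.trans (by gcongr)
  refine lt_max_mul_rpow_of_mul_lt (by positivity) (sub_pos.2 hτ) hδ hρ hκμ1 (by linarith) ?_
  linarith
end

section
/- Let X be a complex Hilbert space, μ, ρ, δ, γ, κ_μ > 0, κ₀ ≥ 1, and set K_opt = ⌈(2(1+γ)δ/(κ_μ·ρ))^{−1/(μ+1)}⌉. Let x†, x_k, x_opt ∈ X, and let k ≥ K_opt be an integer with k ≥ 1. Assume the error estimates ‖x† − x_k‖ ≤ κ_μ·ρ·k^{−μ} + 2(1+γ)·κ₀·k·δ and ‖x† − x_opt‖ ≤ κ_μ·ρ·K_opt^{−μ} + 2(1+γ)·κ₀·K_opt·δ. Then ‖x_k − x_opt‖ ≤ 8(1+γ)·κ₀·k·δ. -/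
theorem Real.rpow_neg_le_mul_of_rpow_neg_one_div_le {μ r t : ℝ} (hμ : 0 < μ + 1) (hr : 0 < r)
    (h : r ^ (-(1 / (μ + 1))) ≤ t) : t ^ (-μ) ≤ r * t := by
  have hs : 0 < r ^ (-(1 / (μ + 1))) := Real.rpow_pos_of_pos hr _
  have ht : 0 < t := hs.trans_le h
  have hpow : t ^ (-(μ + 1)) ≤ r := by
    have := Real.rpow_le_rpow_of_nonpos hs h (by linarith : -(μ + 1) ≤ 0)
    rwa [← Real.rpow_mul hr.le, neg_mul_neg, one_div_mul_cancel hμ.ne', Real.rpow_one] at this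
  calc t ^ (-μ) = t ^ (-(μ + 1)) * t := by
        rw [← Real.rpow_add_one ht.ne']
        congr 1
        ring
    _ ≤ r * t := mul_le_mul_of_nonneg_right hpow ht.le

theorem stmt_13 {X : Type*} [NormedAddCommGroup X] [InnerProductSpace ℂ X]
    (μ ρ δ γ κμ κ₀ : ℝ) (hμ : 0 < μ) (hρ : 0 < ρ) (hδ : 0 < δ) (hγ : 0 < γ)
    (hκμ : 0 < κμ) (hκ₀ : 1 ≤ κ₀) (Kopt : ℕ)
    (hK : Kopt = ⌈(2 * (1 + γ) * δ / (κμ * ρ)) ^ (-(1 / (μ + 1)))⌉₊)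
    (xdag xk xopt : X) (k : ℕ) (hk1 : 1 ≤ k) (hkK : Kopt ≤ k)
    (h1 : ‖xdag - xk‖ ≤ κμ * ρ * (k : ℝ) ^ (-μ) + 2 * (1 + γ) * κ₀ * (k : ℝ) * δ)
    (h2 : ‖xdag - xopt‖ ≤ κμ * ρ * (Kopt : ℝ) ^ (-μ) + 2 * (1 + γ) * κ₀ * (Kopt : ℝ) * δ) :
    ‖xk - xopt‖ ≤ 8 * (1 + γ) * κ₀ * (k : ℝ) * δ := by
  have hb : 0 < κμ * ρ := mul_pos hκμ hρ
  have ha : 0 < 2 * (1 + γ) * δ := by positivity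
  have hbias (m : ℕ) (hm : Kopt ≤ m) :
      κμ * ρ * (m : ℝ) ^ (-μ) ≤ 2 * (1 + γ) * δ * m := by
    have := Real.rpow_neg_le_mul_of_rpow_neg_one_div_le (by linarith) (div_pos ha hb)
      (Nat.ceil_le.mp (hK ▸ hm))
    calc κμ * ρ * (m : ℝ) ^ (-μ)
        ≤ κμ * ρ * (2 * (1 + γ) * δ / (κμ * ρ) * m) := mul_le_mul_of_nonneg_left this hb.le
      _ = 2 * (1 + γ) * δ * m := by rw [← mul_assoc, mul_div_cancel₀ _ hb.ne']
  have herr (m : ℕ) (hm : Kopt ≤ m) (hmk : m ≤ k) :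
      κμ * ρ * (m : ℝ) ^ (-μ) + 2 * (1 + γ) * κ₀ * (m : ℝ) * δ ≤
        4 * (1 + γ) * κ₀ * (k : ℝ) * δ := by
    have hmk' : (m : ℝ) ≤ k := Nat.cast_le.mpr hmk
    calc κμ * ρ * (m : ℝ) ^ (-μ) + 2 * (1 + γ) * κ₀ * (m : ℝ) * δ
        ≤ 2 * (1 + γ) * δ * m * κ₀ + 2 * (1 + γ) * κ₀ * (m : ℝ) * δ := by
          exact add_le_add_left
            ((hbias m hm).trans (le_mul_of_one_le_right (by positivity) hκ₀)) _
      _ = 4 * (1 + γ) * κ₀ * (m : ℝ) * δ := by ring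
      _ ≤ 4 * (1 + γ) * κ₀ * (k : ℝ) * δ := by gcongr
  have htri : ‖xk - xopt‖ ≤ ‖xdag - xk‖ + ‖xdag - xopt‖ := by
    rw [norm_sub_rev xdag xk]
    exact norm_sub_le_norm_sub_add_norm_sub xk xdag xopt
  linarith [herr k hkK le_rfl, herr Kopt le_rfl hkK]
end

section
/- Let r, μ, γ, δ, ρ, c₂ > 0 be real numbers, let n ≥ 2 and K ≥ 0 be integers, and suppose (1 + 2^{r+3})·2^{−2r(n−1)}·(n−1) > γδ/(2(K+1)ρ) and K + 1 < c₂·ρ^{1/(μ+1)}·δ^{−1/(μ+1)}. Then n < c₄ + c₅·ln(ρ/δ), where c₄ = (1/(r·ln 2))·ln( (c₂/γ)·2^{r+1}·(1 + 2^{r+3})/(2^r − 1) ) and c₅ = (1/(r·ln 2))·(μ+2)/(μ+1). -/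
theorem stmt_15 (r μ γ δ ρ c₂ : ℝ) (hr : 0 < r) (hμ : 0 < μ) (hγ : 0 < γ)
    (hδ : 0 < δ) (hρ : 0 < ρ) (hc₂ : 0 < c₂) (n K : ℕ) (hn : 2 ≤ n)
    (h1 : γ * δ / (2 * ((K : ℝ) + 1) * ρ) <
      (1 + (2:ℝ) ^ (r + 3)) * (2:ℝ) ^ (-(2 * r * ((n : ℝ) - 1))) * ((n : ℝ) - 1))
    (h2 : (K : ℝ) + 1 < c₂ * ρ ^ (1 / (μ + 1)) * δ ^ (-(1 / (μ + 1)))) :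
    (n : ℝ) < (1 / (r * Real.log 2)) *
        Real.log ((c₂ / γ) * (2:ℝ) ^ (r + 1) * (1 + (2:ℝ) ^ (r + 3)) / ((2:ℝ) ^ r - 1)) +
      (1 / (r * Real.log 2)) * ((μ + 2) / (μ + 1)) * Real.log (ρ / δ) := by
  have ha1 : 1 < (2:ℝ) ^ r := Real.one_lt_rpow (by norm_num) hr
  obtain ⟨m, rfl⟩ : ∃ m, n = m + 1 := ⟨n - 1, by omega⟩
  have hexp : (2:ℝ) ^ (-(2 * r * (((m + 1 : ℕ) : ℝ) - 1))) = ((((2:ℝ) ^ r) ^ m) ^ 2)⁻¹ := by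
    rw [Real.rpow_neg (by norm_num), ← pow_mul, ← Real.rpow_mul_natCast (by norm_num)]
    push_cast
    ring_nf
  have htwo : (2:ℝ) ^ (r + 1) = 2 * (2:ℝ) ^ r := by
    rw [Real.rpow_add_one (by norm_num), mul_comm]
  have hratio : ρ ^ (1 / (μ + 1)) * δ ^ (-(1 / (μ + 1))) * (ρ / δ) =
      (ρ / δ) ^ ((μ + 2) / (μ + 1)) := by
    rw [show (μ + 2) / (μ + 1) = 1 / (μ + 1) + 1 by field_simp; ring,
      Real.rpow_add_one (by positivity), Real.div_rpow hρ.le hδ.le, Real.rpow_neg hδ.le,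
      div_eq_mul_inv (ρ ^ _)]
  have hlog2 : 0 < Real.log 2 := Real.log_pos (by norm_num)
  rw [hexp] at h1
  rw [htwo]
  have hC : 0 < 1 + (2:ℝ) ^ (r + 3) := by positivity
  have hloga : Real.log ((2:ℝ) ^ r) = r * Real.log 2 := Real.log_rpow (by norm_num) r
  generalize 1 + (2:ℝ) ^ (r + 3) = C at *
  generalize (2:ℝ) ^ r = a at *
  have ha : 0 < a - 1 := sub_pos.2 ha1
  have ha0 : 0 < a := one_pos.trans ha1
  have hpow : a ^ m < 2 * (((K : ℝ) + 1) * (ρ / δ)) * C / (γ * (a - 1)) := by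
    have hbern : (m : ℝ) < a ^ m / (a - 1) := by
      rw [lt_div_iff₀ ha]
      linarith [one_add_mul_sub_le_pow (by linarith : -1 ≤ a) m]
    have h3 : γ * δ / (2 * ((K : ℝ) + 1) * ρ) < C * ((a ^ m) ^ 2)⁻¹ * (a ^ m / (a - 1)) := by
      refine h1.trans ?_
      push_cast
      rw [add_sub_cancel_right]
      gcongr
    rw [show C * ((a ^ m) ^ 2)⁻¹ * (a ^ m / (a - 1)) = C / (a ^ m * (a - 1)) by field_simp,
      div_lt_div_iff₀ (by positivity) (by positivity)] at h3
    rw [show 2 * (((K : ℝ) + 1) * (ρ / δ)) * C / (γ * (a - 1)) =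
      2 * ((K : ℝ) + 1) * ρ * C / (γ * δ * (a - 1)) by field_simp, lt_div_iff₀ (by positivity)]
    linarith
  have hmain : a ^ (m + 1) <
      (c₂ / γ * (2 * a) * C / (a - 1)) * (ρ / δ) ^ ((μ + 2) / (μ + 1)) := by
    calc a ^ (m + 1) = a ^ m * a := pow_succ a m
      _ < 2 * (((K : ℝ) + 1) * (ρ / δ)) * C / (γ * (a - 1)) * a := by gcongr
      _ < 2 * (c₂ * ρ ^ (1 / (μ + 1)) * δ ^ (-(1 / (μ + 1))) * (ρ / δ)) * C /
          (γ * (a - 1)) * a := by gcongr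
      _ = _ := by
        rw [← hratio]
        field_simp
  have hlog := Real.log_lt_log (by positivity) hmain
  rw [Real.log_mul (by positivity) (by positivity), Real.log_rpow (by positivity), Real.log_pow,
    hloga] at hlog
  rw [mul_assoc (1 / (r * Real.log 2)), ← mul_add, one_div_mul_eq_div,
    lt_div_iff₀ (by positivity)]
  exact hlog
end

section
/- Let r, μ, γ, δ, ρ, c₂ > 0 be real numbers, let n ≥ 2 and K ≥ 0 be integers, and suppose (1 + 2^{r+3})·2^{−2r(n−1)}·(n−1) > γδ/(2(K+1)ρ) and K + 1 < c₂·ρ^{1/(μ+1)}·δ^{−1/(μ+1)}. Then 2^{2n}·(n+1) < c₃·(ρ/δ)^{(μ+2)/(r(μ+1))}·(1 + c₄ + c₅·ln(ρ/δ))^{1 + 1/r}, where c₃ = ((c₂/γ)·2^{2r+1}·(1 + 2^{r+3}))^{1/r}, c₄ = (1/(r·ln 2))·ln( (c₂/γ)·2^{r+1}·(1 + 2^{r+3})/(2^r − 1) ) and c₅ = (1/(r·ln 2))·(μ+2)/(μ+1). -/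
/-- The hypotheses on the discretization level `m + 1` and on the number of steps `K + 1`,
combined into one bound with `K` eliminated. -/
theorem rpow_lt_of_level_bound {r μ γ δ ρ c₂ C m k : ℝ} (hμ : 0 < μ) (hγ : 0 < γ)
    (hδ : 0 < δ) (hρ : 0 < ρ) (hC : 0 < C) (hm : 0 < m) (hk : 0 < k)
    (h1 : γ * δ / (2 * k * ρ) < C * (2:ℝ) ^ (-(2 * r * m)) * m)
    (h2 : k < c₂ * ρ ^ (1 / (μ + 1)) * δ ^ (-(1 / (μ + 1)))) :
    (2:ℝ) ^ (2 * r * m) < 2 * (c₂ / γ) * C * (ρ / δ) ^ ((μ + 2) / (μ + 1)) * m := by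
  have hx : 0 < ρ / δ := div_pos hρ hδ
  have hexp : (μ + 2) / (μ + 1) = 1 + 1 / (μ + 1) := by field_simp; ring
  have hpow : ρ ^ (1 / (μ + 1)) * δ ^ (-(1 / (μ + 1))) = (ρ / δ) ^ (1 / (μ + 1)) := by
    rw [Real.div_rpow hρ.le hδ.le, Real.rpow_neg hδ.le, ← div_eq_mul_inv]
  rw [mul_assoc, hpow] at h2
  rw [hexp, Real.rpow_add hx, Real.rpow_one]
  rw [Real.rpow_neg (by norm_num), div_lt_iff₀ (by positivity)] at h1
  set P := (2:ℝ) ^ (2 * r * m)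
  set X := (ρ / δ) ^ (1 / (μ + 1))
  have hP0 : 0 < P := by positivity
  have h3 : γ * δ * P < 2 * C * m * ρ * k := by
    calc γ * δ * P < C * P⁻¹ * m * (2 * k * ρ) * P := by gcongr
      _ = 2 * C * m * ρ * k := by field_simp
  have h4 : γ * δ * P < 2 * C * m * ρ * (c₂ * X) := h3.trans (by gcongr)
  calc P = γ * δ * P / (γ * δ) := by field_simp
    _ < 2 * C * m * ρ * (c₂ * X) / (γ * δ) := by gcongr
    _ = 2 * (c₂ / γ) * C * (ρ / δ * X) * m := by field_simp

/-- A bound `2 ^ (2 * r * m) < D * m` implies a logarithmic bound on `m + 1`. -/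
theorem succ_le_logb_of_rpow_lt {r D : ℝ} {m : ℕ} (hr : 0 < r) (hD : 0 < D)
    (h : (2:ℝ) ^ (2 * r * m) < D * m) :
    (m : ℝ) + 1 ≤ 1 / (r * Real.log 2) * Real.log (2 ^ r * D / (2 ^ r - 1)) := by
  have hq : 1 < (2:ℝ) ^ r := Real.one_lt_rpow (by norm_num) hr
  have hq' : 0 < (2:ℝ) ^ r - 1 := sub_pos.2 hq
  have hbern : (m : ℝ) * (2 ^ r - 1) ≤ 2 ^ (r * m) := by
    have := one_add_mul_sub_le_pow (a := (2:ℝ) ^ r) (by linarith) m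
    rw [Real.rpow_mul (by norm_num), Real.rpow_natCast]
    linarith
  have hsplit : (2:ℝ) ^ (2 * r * m) = 2 ^ (r * m) * 2 ^ (r * m) := by
    rw [← Real.rpow_add (by norm_num)]; ring_nf
  have hle : (2:ℝ) ^ (r * m) * (2 ^ r - 1) ≤ D := by
    have hP : 0 < (2:ℝ) ^ (r * m) := by positivity
    rw [hsplit] at h
    refine le_of_mul_le_mul_left ?_ hP
    calc (2:ℝ) ^ (r * m) * (2 ^ (r * m) * (2 ^ r - 1))
        = 2 ^ (r * m) * 2 ^ (r * m) * (2 ^ r - 1) := by ring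
      _ ≤ D * m * (2 ^ r - 1) := by gcongr
      _ = D * (m * (2 ^ r - 1)) := by ring
      _ ≤ D * 2 ^ (r * m) := by gcongr
      _ = 2 ^ (r * m) * D := by ring
  have hlog2 : 0 < Real.log 2 := Real.log_pos (by norm_num)
  rw [one_div, inv_mul_eq_div, le_div_iff₀ (by positivity)]
  rw [show ((m : ℝ) + 1) * (r * Real.log 2) = Real.log (2 ^ (r * m + r)) by
    rw [Real.log_rpow (by norm_num)]; ring]
  refine Real.log_le_log (by positivity) ?_
  rw [le_div_iff₀ hq', Real.rpow_add (by norm_num)]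
  calc (2:ℝ) ^ (r * m) * 2 ^ r * (2 ^ r - 1) = 2 ^ r * (2 ^ (r * m) * (2 ^ r - 1)) := by ring
    _ ≤ 2 ^ r * D := by gcongr

theorem stmt_16 (r μ γ δ ρ c₂ : ℝ) (hr : 0 < r) (hμ : 0 < μ) (hγ : 0 < γ)
    (hδ : 0 < δ) (hρ : 0 < ρ) (hc₂ : 0 < c₂) (n K : ℕ) (hn : 2 ≤ n)
    (h1 : γ * δ / (2 * ((K : ℝ) + 1) * ρ) <
      (1 + (2:ℝ) ^ (r + 3)) * (2:ℝ) ^ (-(2 * r * ((n : ℝ) - 1))) * ((n : ℝ) - 1))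
    (h2 : (K : ℝ) + 1 < c₂ * ρ ^ (1 / (μ + 1)) * δ ^ (-(1 / (μ + 1)))) :
    (2:ℝ) ^ (2 * n) * ((n : ℝ) + 1) <
      ((c₂ / γ) * (2:ℝ) ^ (2 * r + 1) * (1 + (2:ℝ) ^ (r + 3))) ^ (1 / r) *
        (ρ / δ) ^ ((μ + 2) / (r * (μ + 1))) *
        (1 + (1 / (r * Real.log 2)) *
            Real.log ((c₂ / γ) * (2:ℝ) ^ (r + 1) * (1 + (2:ℝ) ^ (r + 3)) / ((2:ℝ) ^ r - 1)) +
          (1 / (r * Real.log 2)) * ((μ + 2) / (μ + 1)) * Real.log (ρ / δ)) ^ (1 + 1 / r) := by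
  obtain ⟨m, rfl⟩ : ∃ m, n = m + 1 := ⟨n - 1, by omega⟩
  have hm : 0 < (m : ℝ) := by exact_mod_cast (by omega : 0 < m)
  have hcast : ((m + 1 : ℕ) : ℝ) = m + 1 := by push_cast; ring
  have hx : 0 < ρ / δ := div_pos hρ hδ
  have hq : 0 < (2:ℝ) ^ r - 1 := sub_pos.2 (Real.one_lt_rpow (by norm_num) hr)
  rw [hcast, add_sub_cancel_right] at h1
  have hC : 0 < 1 + (2:ℝ) ^ (r + 3) := by positivity
  have hkey := rpow_lt_of_level_bound hμ hγ hδ hρ hC hm (by positivity) h1 h2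
  have hlevel := succ_le_logb_of_rpow_lt hr (by positivity) hkey
  rw [hcast]
  set C := 1 + (2:ℝ) ^ (r + 3)
  set a := (μ + 2) / (μ + 1) with ha
  have hlog : 1 / (r * Real.log 2) *
        Real.log (2 ^ r * (2 * (c₂ / γ) * C * (ρ / δ) ^ a) / (2 ^ r - 1)) =
      1 / (r * Real.log 2) * Real.log (c₂ / γ * 2 ^ (r + 1) * C / (2 ^ r - 1)) +
        1 / (r * Real.log 2) * a * Real.log (ρ / δ) := by
    rw [show (2:ℝ) ^ r * (2 * (c₂ / γ) * C * (ρ / δ) ^ a) / (2 ^ r - 1) =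
        c₂ / γ * 2 ^ (r + 1) * C / (2 ^ r - 1) * (ρ / δ) ^ a by
      rw [Real.rpow_add (by norm_num), Real.rpow_one]; ring,
      Real.log_mul (by positivity) (by positivity), Real.log_rpow hx]
    ring
  rw [hlog] at hlevel
  rw [add_assoc 1]
  set L := 1 / (r * Real.log 2) * Real.log (c₂ / γ * 2 ^ (r + 1) * C / (2 ^ r - 1)) +
    1 / (r * Real.log 2) * a * Real.log (ρ / δ)
  have hL : 0 < 1 + L := by linarith
  have hmL : (m : ℝ) ≤ 1 + L := by linarith
  have hmL_two : (m : ℝ) + 1 + 1 ≤ 1 + L := by linarith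
  have hbase : (2:ℝ) ^ (2 * r * ((m : ℝ) + 1)) <
      c₂ / γ * 2 ^ (2 * r + 1) * C * (ρ / δ) ^ a * m := by
    calc (2:ℝ) ^ (2 * r * ((m : ℝ) + 1)) = 2 ^ (2 * r) * 2 ^ (2 * r * (m : ℝ)) := by
          rw [← Real.rpow_add (by norm_num)]; ring_nf
      _ < 2 ^ (2 * r) * (2 * (c₂ / γ) * C * (ρ / δ) ^ a * m) := by gcongr
      _ = c₂ / γ * 2 ^ (2 * r + 1) * C * (ρ / δ) ^ a * m := by
          rw [Real.rpow_add (by norm_num), Real.rpow_one]; ring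
  have hcard : (2:ℝ) ^ (2 * (m + 1)) <
      (c₂ / γ * 2 ^ (2 * r + 1) * C) ^ (1 / r) * (ρ / δ) ^ ((μ + 2) / (r * (μ + 1))) *
        (m : ℝ) ^ (1 / r) := by
    calc (2:ℝ) ^ (2 * (m + 1)) = (2 ^ (2 * r * ((m : ℝ) + 1))) ^ (1 / r) := by
          rw [← Real.rpow_mul (by norm_num), ← Real.rpow_natCast]
          congr 1
          push_cast
          field_simp
      _ < (c₂ / γ * 2 ^ (2 * r + 1) * C * (ρ / δ) ^ a * m) ^ (1 / r) :=
          Real.rpow_lt_rpow (by positivity) hbase (by positivity)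
      _ = _ := by
          rw [Real.mul_rpow (by positivity) (by positivity),
            Real.mul_rpow (by positivity) (by positivity), ← Real.rpow_mul hx.le]
          congr 3
          rw [ha]
          field_simp
  rw [Real.rpow_add hL, Real.rpow_one]
  calc (2:ℝ) ^ (2 * (m + 1)) * ((m : ℝ) + 1 + 1)
      < (c₂ / γ * 2 ^ (2 * r + 1) * C) ^ (1 / r) * (ρ / δ) ^ ((μ + 2) / (r * (μ + 1))) *
        (m : ℝ) ^ (1 / r) * ((m : ℝ) + 1 + 1) := by gcongr
    _ ≤ (c₂ / γ * 2 ^ (2 * r + 1) * C) ^ (1 / r) * (ρ / δ) ^ ((μ + 2) / (r * (μ + 1))) *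
        (1 + L) ^ (1 / r) * (1 + L) := by gcongr ?_ * ?_ ^ _ * ?_
    _ = _ := by ring
end
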